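/- Let N ≥ 2 and let π₁,…,π_D be permutations of {1,…,N} with associated permutation matrices P(1),…,P(D). Suppose there is ε ∈ (0,1] such that ‖(1/D)∑_{s=1}^D P(s)⊗P(s) − |φ₁⟩⟨φ₁| − |φ₂⟩⟨φ₂|‖ ≤ 1 − ε. Let Z := ∑_{j=1}^N e^{2πij/N} |j⟩⟨j| and p := 1/(1+ε). Then ‖(p/D)∑_{s=1}^D P(s)⊗P(s) + ((1−p)/2)(Z⊗Z* + Z†⊗(Z†)*) − |φ₁⟩⟨φ₁|‖ ≤ 1 − ε/48, i.e. the quantum operation with Kraus operators √(p/D)P(1),…,√(p/D)P(D), √((1−p)/2)Z, √((1−p)/2)Z† is an (N,D+2,1−ε/48) quantum expander. -/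

import Mathlib

open scoped Kronecker Matrix BigOperators

noncomputable section

/-- The ℓ₂→ℓ₂ operator norm (largest singular value) of a complex matrix. -/
def opNorm {n : Type*} [Fintype n] [DecidableEq n] (A : Matrix n n ℂ) : ℝ :=
  ‖Matrix.toEuclideanCLM (𝕜 := ℂ) A‖

/-- Permutation matrix: entry (i,j) is 1 iff π j = i. -/
def permMat (N : ℕ) (π : Equiv.Perm (Fin N)) : Matrix (Fin N) (Fin N) ℂ :=
  Matrix.of fun i j => if π j = i then 1 else 0

/-- The projection |φ₁⟩⟨φ₁| onto the maximally entangled state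
φ₁ = (1/√N) ∑ᵢ eᵢ⊗eᵢ. -/
def phi1Proj (N : ℕ) : Matrix (Fin N × Fin N) (Fin N × Fin N) ℂ :=
  Matrix.of fun p q => if p.1 = p.2 ∧ q.1 = q.2 then (N : ℂ)⁻¹ else 0

/-- The projection |φ₂⟩⟨φ₂| where φ₂ = (1/√(N(N-1))) ∑_{i≠j} eᵢ⊗eⱼ. -/
def phi2Proj (N : ℕ) : Matrix (Fin N × Fin N) (Fin N × Fin N) ℂ :=
  Matrix.of fun p q =>
    if p.1 ≠ p.2 ∧ q.1 ≠ q.2 then ((N : ℂ) * ((N : ℂ) - 1))⁻¹ else 0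

/-- The diagonal phase matrix Z = ∑_{j=1}^N e^{2πij/N} |j⟩⟨j|. -/
def Zmat (N : ℕ) : Matrix (Fin N) (Fin N) ℂ :=
  Matrix.diagonal fun j =>
    Complex.exp (((2 * Real.pi : ℝ) : ℂ) * Complex.I * (((j : ℕ) : ℂ) + 1) / (N : ℂ))

theorem norm_sq_bound_of_split {ε α β t : ℝ} (hε0 : 0 < ε) (hε1 : ε ≤ 1)
    (h₁ : t ≤ α ^ 2 + β ^ 2) (h₂ : t ≤ 2 * α * β + β ^ 2) :
    α ^ 2 + (1 - ε) ^ 2 * β ^ 2 + ε ^ 2 * (α ^ 2 + β ^ 2) + 2 * ε * t ≤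
      ((1 - ε / 48) * (1 + ε)) ^ 2 * (α ^ 2 + β ^ 2) := by
  have key : 2 * t ≤ 11 / 6 * (α ^ 2 + β ^ 2) + β ^ 2 := by
    rcases le_total (α ^ 2) (5 * β ^ 2) with h | h
    · linarith
    · nlinarith [sq_nonneg (9 * α - 20 * β), sq_nonneg β]
  have hcoef : (1 + ε) ^ 2 - ε / 6 ≤ ((1 - ε / 48) * (1 + ε)) ^ 2 := by
    have : ε * (1 + ε) ^ 2 ≤ ε * 4 := by gcongr; nlinarith
    nlinarith [sq_nonneg (ε * (1 + ε))]
  have hs : 0 ≤ α ^ 2 + β ^ 2 := by positivity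
  have h₃ := mul_le_mul_of_nonneg_right hcoef hs
  have h₄ := mul_le_mul_of_nonneg_left key hε0.le
  have h₅ : 0 ≤ ε * (1 - ε) * β ^ 2 :=
    mul_nonneg (mul_nonneg hε0.le (sub_nonneg.2 hε1)) (sq_nonneg β)
  nlinarith

section InnerProduct

variable {H : Type*} [NormedAddCommGroup H] [InnerProductSpace ℂ H]

open scoped InnerProductSpace

theorem norm_sq_eq_component_add (v x : H) (hv : ‖v‖ = 1) :
    ‖x‖ ^ 2 = ‖⟪v, x⟫_ℂ‖ ^ 2 + ‖x - ⟪v, x⟫_ℂ • v‖ ^ 2 := by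
  have horth : ⟪⟪v, x⟫_ℂ • v, x - ⟪v, x⟫_ℂ • v⟫_ℂ = 0 := by
    rw [inner_smul_left, inner_sub_right, inner_smul_right, inner_self_eq_norm_sq_to_K, hv]
    simp
  have h := norm_add_sq_eq_norm_sq_add_norm_sq_of_inner_eq_zero _ _ horth
  rw [add_sub_cancel, norm_smul, hv, mul_one] at h
  simpa [sq] using h

theorem norm_rankOne_perturbation_le {ε : ℝ} (hε0 : 0 < ε) (hε1 : ε ≤ 1) {v : H}
    (hv : ‖v‖ = 1) (E B : H →L[ℂ] H) (hE : ‖E‖ ≤ 1 - ε) (hEv : E v = 0)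
    (hvE : ∀ y, ⟪v, E y⟫_ℂ = 0) (hB : ‖B‖ ≤ 1) (hvB : (⟪v, B v⟫_ℂ).re ≤ 0) (x : H) :
    ‖E x + ⟪v, x⟫_ℂ • v + (ε : ℂ) • B x‖ ≤ (1 - ε / 48) * (1 + ε) * ‖x‖ := by
  set a : ℂ := ⟪v, x⟫_ℂ with ha
  set y : H := x - a • v with hy
  have hx : x = a • v + y := by simp [hy]
  have hnx : ‖x‖ ^ 2 = ‖a‖ ^ 2 + ‖y‖ ^ 2 := norm_sq_eq_component_add v x hv
  have hEx : E x = E y := by simp [hy, hEv]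
  have hEy : ‖E y‖ ≤ (1 - ε) * ‖y‖ := E.le_of_opNorm_le hE y
  have hEy' : ‖E y‖ ≤ ‖y‖ := hEy.trans (by nlinarith [norm_nonneg y])
  have hBc : ∀ z, ‖B z‖ ≤ ‖z‖ := fun z => by simpa using B.le_of_opNorm_le hB z
  set w : H := E y + a • v with hw
  have hnw : ‖w‖ ^ 2 = ‖E y‖ ^ 2 + ‖a‖ ^ 2 := by
    have horth : ⟪E y, a • v⟫_ℂ = 0 := by
      rw [inner_smul_right, inner_eq_zero_symm.1 (hvE y), mul_zero]
    have h := norm_add_sq_eq_norm_sq_add_norm_sq_of_inner_eq_zero _ _ horth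
    rw [norm_smul, hv, mul_one] at h
    simpa [sq] using h
  have hnw' : ‖w‖ ^ 2 ≤ ‖a‖ ^ 2 + (1 - ε) ^ 2 * ‖y‖ ^ 2 := by
    have := pow_le_pow_left₀ (norm_nonneg _) hEy 2
    rw [mul_pow] at this
    linarith
  have hwx : ‖w‖ ≤ ‖x‖ := by
    apply le_of_sq_le_sq _ (norm_nonneg x)
    have := pow_le_pow_left₀ (norm_nonneg _) hEy' 2
    linarith
  have hre : ∀ u z : H, (⟪u, z⟫_ℂ).re ≤ ‖u‖ * ‖z‖ := fun u z => re_inner_le_norm (𝕜 := ℂ) u z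
  have ht₁ : (⟪w, B x⟫_ℂ).re ≤ ‖a‖ ^ 2 + ‖y‖ ^ 2 := by
    calc _ ≤ ‖w‖ * ‖B x‖ := hre _ _
      _ ≤ ‖x‖ * ‖x‖ := by gcongr; exact hBc x
      _ = _ := by rw [← sq, hnx]
  have ht₂ : (⟪w, B x⟫_ℂ).re ≤ 2 * ‖a‖ * ‖y‖ + ‖y‖ ^ 2 := by
    have e : ⟪w, B x⟫_ℂ = ⟪E y, B (a • v)⟫_ℂ + ⟪E y, B y⟫_ℂ + ⟪a • v, B y⟫_ℂ +
        ⟪a • v, B (a • v)⟫_ℂ := by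
      rw [hw, hx, map_add]; simp only [inner_add_left, inner_add_right]; ring
    have e' : (⟪a • v, B (a • v)⟫_ℂ).re ≤ 0 := by
      rw [map_smul, inner_smul_left, inner_smul_right, ← mul_assoc, mul_comm _ a,
        Complex.mul_conj, Complex.re_ofReal_mul]
      exact mul_nonpos_of_nonneg_of_nonpos (Complex.normSq_nonneg a) hvB
    have hav : ‖a • v‖ = ‖a‖ := by rw [norm_smul, hv, mul_one]
    have b₁ : (⟪E y, B (a • v)⟫_ℂ).re ≤ ‖y‖ * ‖a‖ :=
      (hre _ _).trans (mul_le_mul hEy' ((hBc _).trans hav.le) (norm_nonneg _) (norm_nonneg _))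
    have b₂ : (⟪E y, B y⟫_ℂ).re ≤ ‖y‖ * ‖y‖ :=
      (hre _ _).trans (mul_le_mul hEy' (hBc _) (norm_nonneg _) (norm_nonneg _))
    have b₃ : (⟪a • v, B y⟫_ℂ).re ≤ ‖a‖ * ‖y‖ :=
      (hre _ _).trans (mul_le_mul hav.le (hBc _) (norm_nonneg _) (norm_nonneg _))
    rw [e]
    simp only [Complex.add_re]
    linarith
  have hT : ‖w + (ε : ℂ) • B x‖ ^ 2 = ‖w‖ ^ 2 + 2 * (ε * (⟪w, B x⟫_ℂ).re) + ε ^ 2 * ‖B x‖ ^ 2 := by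
    rw [norm_add_sq (𝕜 := ℂ), inner_smul_right, norm_smul, mul_pow, Complex.norm_real,
      Real.norm_eq_abs, sq_abs]
    simp
  have hBx := pow_le_pow_left₀ (norm_nonneg _) (hBc x) 2
  have hfin := norm_sq_bound_of_split hε0 hε1 ht₁ ht₂
  rw [hEx]
  have hc : 0 ≤ 1 - ε / 48 := by linarith
  apply le_of_sq_le_sq _ (by positivity)
  rw [hT, mul_pow, hnx]
  have := mul_le_mul_of_nonneg_left hBx (sq_nonneg ε)
  rw [hnx] at this
  linarith

theorem norm_sub_component_le {u : H} (hu : ‖u‖ = 1) (B : H →L[ℂ] H) (hB : ‖B‖ ≤ 1)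
    (hBu : B u = u) (x : H) : ‖B x - ⟪u, x⟫_ℂ • u‖ ≤ ‖x‖ := by
  have e : B x - ⟪u, x⟫_ℂ • u = B (x - ⟪u, x⟫_ℂ • u) := by simp [hBu]
  rw [e]
  refine (B.le_of_opNorm_le hB _).trans ?_
  rw [one_mul]
  apply le_of_sq_le_sq _ (norm_nonneg x)
  rw [norm_sq_eq_component_add u x hu]
  nlinarith [sq_nonneg ‖⟪u, x⟫_ℂ‖]

end InnerProduct

section RankOne

variable {n : Type*} [Fintype n] [DecidableEq n]

theorem inner_toLp_toEuclideanCLM (f : n → ℂ) (A : Matrix n n ℂ) (x : EuclideanSpace ℂ n) :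
    inner ℂ (WithLp.toLp 2 f) (Matrix.toEuclideanCLM (𝕜 := ℂ) A x) =
      (star f ᵥ* A) ⬝ᵥ x.ofLp := by
  rw [EuclideanSpace.inner_eq_star_dotProduct, Matrix.ofLp_toEuclideanCLM, dotProduct_comm,
    Matrix.dotProduct_mulVec]

theorem toEuclideanCLM_vecMulVec_star (f : n → ℂ) (x : EuclideanSpace ℂ n) :
    Matrix.toEuclideanCLM (𝕜 := ℂ) (Matrix.vecMulVec f (star f)) x =
      inner ℂ (WithLp.toLp 2 f) x • WithLp.toLp 2 f := by
  ext i
  rw [Matrix.ofLp_toEuclideanCLM, EuclideanSpace.inner_eq_star_dotProduct,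
    Matrix.vecMulVec_mulVec, dotProduct_comm]
  simp [mul_comm]

theorem norm_toEuclideanCLM_diagonal_le_one {d : n → ℂ} (hd : ∀ i, ‖d i‖ ≤ 1) :
    ‖Matrix.toEuclideanCLM (𝕜 := ℂ) (Matrix.diagonal d)‖ ≤ 1 := by
  open scoped Matrix.Norms.L2Operator in
  rw [Matrix.l2_opNorm_toEuclideanCLM, Matrix.l2_opNorm_diagonal]
  exact (pi_norm_le_iff_of_nonneg zero_le_one).2 hd

end RankOne

theorem permMat_kronecker_mulVec {N : ℕ} (π : Equiv.Perm (Fin N)) {f : Fin N × Fin N → ℂ}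
    (hf : ∀ i j, f (π i, π j) = f (i, j)) :
    (permMat N π ⊗ₖ permMat N π) *ᵥ f = f := by
  ext ⟨i, j⟩
  obtain ⟨i, rfl⟩ := π.surjective i
  obtain ⟨j, rfl⟩ := π.surjective j
  simp [Matrix.mulVec, dotProduct, Fintype.sum_prod_type, permMat, hf]

theorem vecMul_permMat_kronecker {N : ℕ} (π : Equiv.Perm (Fin N)) {f : Fin N × Fin N → ℂ}
    (hf : ∀ i j, f (π i, π j) = f (i, j)) :
    f ᵥ* (permMat N π ⊗ₖ permMat N π) = f := by
  ext ⟨i, j⟩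
  simp [Matrix.vecMul, dotProduct, Fintype.sum_prod_type, permMat, hf]

/-- The coordinates of `φ₁`. -/
def phi1 (N : ℕ) (p : Fin N × Fin N) : ℂ :=
  if p.1 = p.2 then ((√(N : ℝ))⁻¹ : ℝ) else 0

/-- The coordinates of `φ₂`. -/
def phi2 (N : ℕ) (p : Fin N × Fin N) : ℂ :=
  if p.1 ≠ p.2 then ((√((N : ℝ) * (N - 1)))⁻¹ : ℝ) else 0

theorem star_phi1 (N : ℕ) : star (phi1 N) = phi1 N := by
  ext p; by_cases h : p.1 = p.2 <;> simp [phi1, h]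

theorem star_phi2 (N : ℕ) : star (phi2 N) = phi2 N := by
  ext p; by_cases h : p.1 = p.2 <;> simp [phi2, h]

theorem phi1Proj_eq (N : ℕ) : phi1Proj N = Matrix.vecMulVec (phi1 N) (star (phi1 N)) := by
  have h : ((√(N : ℝ))⁻¹ : ℝ) * (√(N : ℝ))⁻¹ = (N : ℝ)⁻¹ := by
    rw [← mul_inv, Real.mul_self_sqrt (Nat.cast_nonneg N)]
  have h' := congrArg Complex.ofReal h
  push_cast at h'
  rw [star_phi1]
  ext p q
  by_cases hp : p.1 = p.2 <;> by_cases hq : q.1 = q.2 <;>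
    simp [phi1Proj, Matrix.vecMulVec_apply, phi1, hp, hq, h']

theorem phi2Proj_eq {N : ℕ} (hN : 2 ≤ N) :
    phi2Proj N = Matrix.vecMulVec (phi2 N) (star (phi2 N)) := by
  have hN' : (2 : ℝ) ≤ N := by exact_mod_cast hN
  have h : ((√((N : ℝ) * (N - 1)))⁻¹ : ℝ) * (√((N : ℝ) * (N - 1)))⁻¹ =
      ((N : ℝ) * (N - 1))⁻¹ := by
    rw [← mul_inv, Real.mul_self_sqrt (by nlinarith)]
  have h' := congrArg Complex.ofReal h
  push_cast at h'
  rw [star_phi2]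
  ext p q
  by_cases hp : p.1 = p.2 <;> by_cases hq : q.1 = q.2 <;>
    simp [phi2Proj, Matrix.vecMulVec_apply, phi2, hp, hq, h', -mul_inv_rev, -Real.sqrt_mul]

theorem sum_ite_ne_prod {N : ℕ} {R : Type*} [AddCommGroup R] (g : Fin N × Fin N → R) :
    ∑ p, (if p.1 ≠ p.2 then g p else 0) = ∑ p, g p - ∑ i, g (i, i) := by
  have h : ∀ p : Fin N × Fin N, (if p.1 ≠ p.2 then g p else 0) =
      g p - if p.1 = p.2 then g p else 0 := fun p => by by_cases hp : p.1 = p.2 <;> simp [hp]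
  simp only [h, Finset.sum_sub_distrib]
  congr 1
  simp [Fintype.sum_prod_type]

theorem norm_phi1 {N : ℕ} (hN : 1 ≤ N) : ‖(WithLp.toLp 2 (phi1 N) : EuclideanSpace ℂ _)‖ = 1 := by
  have hN' : (N : ℝ) ≠ 0 := by positivity
  rw [EuclideanSpace.norm_eq, Real.sqrt_eq_one]
  have h : ∀ p : Fin N × Fin N, ‖phi1 N p‖ ^ 2 = if p.1 = p.2 then (N : ℝ)⁻¹ else 0 := fun p => by
    by_cases hp : p.1 = p.2 <;> simp [phi1, hp]
  simp [h, Fintype.sum_prod_type, hN']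

theorem norm_phi2 {N : ℕ} (hN : 2 ≤ N) : ‖(WithLp.toLp 2 (phi2 N) : EuclideanSpace ℂ _)‖ = 1 := by
  have hN' : (2 : ℝ) ≤ N := by exact_mod_cast hN
  have hpos : 0 < (N : ℝ) * (N - 1) := by nlinarith
  rw [EuclideanSpace.norm_eq, Real.sqrt_eq_one]
  have h : ∀ p : Fin N × Fin N, ‖phi2 N p‖ ^ 2 =
      if p.1 ≠ p.2 then ((N : ℝ) * (N - 1))⁻¹ else 0 := fun p => by
    by_cases hp : p.1 = p.2
    · simp [phi2, hp]
    · rw [phi2, if_pos hp, if_pos hp, Complex.norm_real, Real.norm_eq_abs, sq_abs, inv_pow,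
        Real.sq_sqrt hpos.le]
  simp only [h, sum_ite_ne_prod (fun _ => ((N : ℝ) * (N - 1))⁻¹)]
  simp only [Finset.sum_const, Finset.card_univ, Fintype.card_prod, Fintype.card_fin, nsmul_eq_mul]
  push_cast
  rw [← sub_mul, ← mul_sub_one, mul_inv_cancel₀ hpos.ne']

theorem phi1_dotProduct_phi2 (N : ℕ) : phi1 N ⬝ᵥ phi2 N = 0 :=
  Finset.sum_eq_zero fun p _ => by by_cases hp : p.1 = p.2 <;> simp [phi1, phi2, hp]

theorem phi2_dotProduct_self {N : ℕ} (hN : 2 ≤ N) : phi2 N ⬝ᵥ phi2 N = 1 := by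
  have h := inner_self_eq_norm_sq_to_K (𝕜 := ℂ) (WithLp.toLp 2 (phi2 N) : EuclideanSpace ℂ _)
  rw [norm_phi2 hN, EuclideanSpace.inner_eq_star_dotProduct, star_phi2] at h
  simpa using h

theorem phi2_perm {N : ℕ} (π : Equiv.Perm (Fin N)) (i j : Fin N) :
    phi2 N (π i, π j) = phi2 N (i, j) := by
  simp [phi2]

/-- The diagonal entries of `Z`. -/
def phase (N : ℕ) (j : Fin N) : ℂ :=
  Complex.exp (((2 * Real.pi : ℝ) : ℂ) * Complex.I * (((j : ℕ) : ℂ) + 1) / (N : ℂ))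

theorem norm_phase (N : ℕ) (j : Fin N) : ‖phase N j‖ = 1 := by
  have h : ((2 * Real.pi : ℝ) : ℂ) * Complex.I * (((j : ℕ) : ℂ) + 1) / (N : ℂ) =
      ((2 * Real.pi * ((j : ℕ) + 1) / N : ℝ) : ℂ) * Complex.I := by push_cast; ring
  rw [phase, h, Complex.norm_exp_ofReal_mul_I]

theorem sum_phase {N : ℕ} (hN : 2 ≤ N) : ∑ j, phase N j = 0 := by
  have hroot := Complex.isPrimitiveRoot_exp N (by lia)
  have h : ∀ j : Fin N, phase N j = Complex.exp (2 * Real.pi * Complex.I / N) *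
      Complex.exp (2 * Real.pi * Complex.I / N) ^ (j : ℕ) := fun j => by
    rw [phase, ← Complex.exp_nat_mul, ← Complex.exp_add]
    congr 1
    push_cast
    ring
  simp only [h, ← Finset.mul_sum]
  rw [Fin.sum_univ_eq_sum_range (fun j => Complex.exp (2 * Real.pi * Complex.I / N) ^ j),
    hroot.geom_sum_eq_zero (by lia), mul_zero]

/-- The diagonal of `(Z ⊗ Z* + Z† ⊗ (Z†)*) / 2`. -/
def phaseCorr (N : ℕ) (p : Fin N × Fin N) : ℂ :=
  (phase N p.1 * star (phase N p.2) + star (phase N p.1) * phase N p.2) / 2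

theorem Zmat_kronecker_add (N : ℕ) :
    Zmat N ⊗ₖ (Zmat N).map (starRingEnd ℂ) + (Zmat N)ᴴ ⊗ₖ ((Zmat N)ᴴ).map (starRingEnd ℂ) =
      (2 : ℂ) • Matrix.diagonal (phaseCorr N) := by
  have hZ : Zmat N = Matrix.diagonal (phase N) := rfl
  rw [hZ, Matrix.diagonal_conjTranspose, Matrix.diagonal_map (map_zero _),
    Matrix.diagonal_map (map_zero _), Matrix.diagonal_kronecker_diagonal,
    Matrix.diagonal_kronecker_diagonal, Matrix.diagonal_add, ← Matrix.diagonal_smul]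
  congr 1
  ext p
  simp [phaseCorr, mul_div_cancel₀]

theorem norm_phaseCorr_le (N : ℕ) (p : Fin N × Fin N) : ‖phaseCorr N p‖ ≤ 1 := by
  rw [phaseCorr, norm_div]
  have := norm_add_le (phase N p.1 * star (phase N p.2)) (star (phase N p.1) * phase N p.2)
  simp only [norm_mul, norm_star, norm_phase] at this
  rw [Complex.norm_ofNat]
  linarith

theorem phaseCorr_self (N : ℕ) (i : Fin N) : phaseCorr N (i, i) = 1 := by
  have h : phase N i * star (phase N i) = 1 := by
    simp [Complex.mul_conj, Complex.normSq_eq_norm_sq, norm_phase]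
  rw [phaseCorr, mul_comm (star _), h]
  norm_num

theorem sum_phaseCorr {N : ℕ} (hN : 2 ≤ N) : ∑ p, phaseCorr N p = 0 := by
  simp only [phaseCorr, ← Finset.sum_div, Finset.sum_add_distrib, Fintype.sum_prod_type,
    ← Finset.mul_sum, ← Finset.sum_mul, ← star_sum, sum_phase hN]
  simp

theorem inner_phi2_diagonal_phaseCorr_re_nonpos {N : ℕ} (hN : 2 ≤ N) :
    (inner ℂ (WithLp.toLp 2 (phi2 N))
      (Matrix.toEuclideanCLM (𝕜 := ℂ) (Matrix.diagonal (phaseCorr N))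
        (WithLp.toLp 2 (phi2 N)))).re ≤ 0 := by
  set c : ℝ := (√((N : ℝ) * (N - 1)))⁻¹ with hc
  have h : ∀ p, phi2 N p * phaseCorr N p * phi2 N p =
      if p.1 ≠ p.2 then ((c ^ 2 : ℝ) : ℂ) * phaseCorr N p else 0 := fun p => by
    by_cases hp : p.1 = p.2
    · simp [phi2, hp]
    · rw [phi2, if_pos hp, if_pos hp, ← hc]; push_cast; ring
  rw [inner_toLp_toEuclideanCLM, star_phi2]
  simp only [dotProduct, Matrix.vecMul_diagonal, h,
    sum_ite_ne_prod (fun p => ((c ^ 2 : ℝ) : ℂ) * phaseCorr N p), ← Finset.mul_sum,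
    sum_phaseCorr hN, phaseCorr_self]
  simp only [Finset.sum_const, Finset.card_univ, Fintype.card_fin, nsmul_eq_mul, mul_zero, mul_one,
    zero_sub, Complex.neg_re, Complex.re_ofReal_mul, Complex.natCast_re]
  have : 0 ≤ c ^ 2 * N := by positivity
  linarith

theorem diagonal_phaseCorr_mulVec_phi1 (N : ℕ) :
    Matrix.diagonal (phaseCorr N) *ᵥ phi1 N = phi1 N := by
  ext ⟨i, j⟩
  rw [Matrix.mulVec_diagonal]
  by_cases hp : i = j
  · subst hp; rw [phaseCorr_self, one_mul]
  · simp [phi1, hp]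

section Expander

variable {N D : ℕ} (ps : Fin D → Equiv.Perm (Fin N))

/-- The part of the averaged two-copy permutation operator left after removing `φ₁` and `φ₂`. -/
def tpeResidual : Matrix (Fin N × Fin N) (Fin N × Fin N) ℂ :=
  (D : ℂ)⁻¹ • ∑ s, permMat N (ps s) ⊗ₖ permMat N (ps s) - phi1Proj N - phi2Proj N

theorem tpeResidual_mulVec_phi2 (hN : 2 ≤ N) (hD : 1 ≤ D) : tpeResidual ps *ᵥ phi2 N = 0 := by
  have hD' : (D : ℂ) ≠ 0 := by exact_mod_cast (by lia : D ≠ 0)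
  simp [tpeResidual, Matrix.sub_mulVec, Matrix.smul_mulVec, Matrix.sum_mulVec,
    permMat_kronecker_mulVec _ (phi2_perm _), phi1Proj_eq, phi2Proj_eq hN,
    Matrix.vecMulVec_mulVec, star_phi1, star_phi2, phi1_dotProduct_phi2,
    phi2_dotProduct_self hN, ← Nat.cast_smul_eq_nsmul ℂ, hD']

theorem phi2_vecMul_tpeResidual (hN : 2 ≤ N) (hD : 1 ≤ D) : phi2 N ᵥ* tpeResidual ps = 0 := by
  have hD' : (D : ℂ) ≠ 0 := by exact_mod_cast (by lia : D ≠ 0)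
  simp [tpeResidual, Matrix.vecMul_sub, Matrix.vecMul_smul, Matrix.vecMul_sum,
    vecMul_permMat_kronecker _ (phi2_perm _), phi1Proj_eq, phi2Proj_eq hN,
    Matrix.vecMul_vecMulVec, star_phi1, star_phi2, dotProduct_comm (phi2 N) (phi1 N),
    phi1_dotProduct_phi2, phi2_dotProduct_self hN, ← Nat.cast_smul_eq_nsmul ℂ, hD']

end Expander

/-- A classical 2-copy tensor product expander with gap ε, augmented by the Hermitian pair
of phase matrices Z, Z† each with weight (1-p)/2 where p = 1/(1+ε), is a quantum expander with gap ε/48. -/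
theorem stmt1 (N D : ℕ) (hN : 2 ≤ N) (hD : 1 ≤ D)
    (ps : Fin D → Equiv.Perm (Fin N)) (ε : ℝ) (hε0 : 0 < ε) (hε1 : ε ≤ 1)
    (hTPE : opNorm ((D : ℂ)⁻¹ • ∑ s, permMat N (ps s) ⊗ₖ permMat N (ps s)
        - phi1Proj N - phi2Proj N) ≤ 1 - ε) :
    opNorm ((((1 / (1 + ε) : ℝ) : ℂ) / (D : ℂ)) •
        ∑ s, permMat N (ps s) ⊗ₖ permMat N (ps s)
      + (((1 - 1 / (1 + ε)) / 2 : ℝ) : ℂ) •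
          (Zmat N ⊗ₖ (Zmat N).map (starRingEnd ℂ)
            + (Zmat N)ᴴ ⊗ₖ ((Zmat N)ᴴ).map (starRingEnd ℂ))
      - phi1Proj N) ≤ 1 - ε / 48 := by
  have hp : (1 + ε) ≠ 0 := by positivity
  have hM : (((1 / (1 + ε) : ℝ) : ℂ) / (D : ℂ)) • ∑ s, permMat N (ps s) ⊗ₖ permMat N (ps s)
      + (((1 - 1 / (1 + ε)) / 2 : ℝ) : ℂ) •
          (Zmat N ⊗ₖ (Zmat N).map (starRingEnd ℂ)
            + (Zmat N)ᴴ ⊗ₖ ((Zmat N)ᴴ).map (starRingEnd ℂ))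
      - phi1Proj N = (((1 + ε)⁻¹ : ℝ) : ℂ) • (tpeResidual ps + phi2Proj N +
        (ε : ℂ) • (Matrix.diagonal (phaseCorr N) - phi1Proj N)) := by
    have h₁ : ((1 - 1 / (1 + ε)) / 2 : ℝ) * 2 = (1 + ε)⁻¹ * ε := by field_simp; ring
    have h₂ : (1 + ε)⁻¹ + (1 + ε)⁻¹ * ε = 1 := by field_simp
    have h₁' := congrArg Complex.ofReal h₁
    have h₂' := congrArg Complex.ofReal h₂
    rw [Complex.ofReal_mul, Complex.ofReal_mul, Complex.ofReal_ofNat] at h₁'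
    rw [Complex.ofReal_add, Complex.ofReal_mul, Complex.ofReal_one] at h₂'
    rw [Zmat_kronecker_add, smul_smul, h₁', tpeResidual, one_div, div_eq_mul_inv]
    generalize (((1 + ε)⁻¹ : ℝ) : ℂ) = p at *
    calc _ = p • (D : ℂ)⁻¹ • (∑ s, permMat N (ps s) ⊗ₖ permMat N (ps s)) +
          (p * ε) • Matrix.diagonal (phaseCorr N) - (p + p * ε) • phi1Proj N := by
            rw [h₂', one_smul, smul_smul]
      _ = _ := by module
  rw [hM, opNorm]
  refine ContinuousLinearMap.opNorm_le_bound _ (by linarith) fun x => ?_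
  have hvE : ∀ y, inner ℂ (WithLp.toLp 2 (phi2 N))
      (Matrix.toEuclideanCLM (𝕜 := ℂ) (tpeResidual ps) y) = 0 := fun y => by
    rw [inner_toLp_toEuclideanCLM, star_phi2, phi2_vecMul_tpeResidual ps hN hD, zero_dotProduct]
  have hEv : Matrix.toEuclideanCLM (𝕜 := ℂ) (tpeResidual ps) (WithLp.toLp 2 (phi2 N)) = 0 := by
    rw [Matrix.toEuclideanCLM_toLp, tpeResidual_mulVec_phi2 ps hN hD, WithLp.toLp_zero]
  have hB : ‖Matrix.toEuclideanCLM (𝕜 := ℂ)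
      (Matrix.diagonal (phaseCorr N) - phi1Proj N)‖ ≤ 1 := by
    refine ContinuousLinearMap.opNorm_le_bound _ zero_le_one fun z => ?_
    rw [one_mul, map_sub, sub_apply, phi1Proj_eq,
      toEuclideanCLM_vecMulVec_star]
    refine norm_sub_component_le (norm_phi1 (by lia)) _
      (norm_toEuclideanCLM_diagonal_le_one (norm_phaseCorr_le N)) ?_ z
    rw [Matrix.toEuclideanCLM_toLp, diagonal_phaseCorr_mulVec_phi1]
  have hvB : (inner ℂ (WithLp.toLp 2 (phi2 N)) (Matrix.toEuclideanCLM (𝕜 := ℂ)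
      (Matrix.diagonal (phaseCorr N) - phi1Proj N) (WithLp.toLp 2 (phi2 N)))).re ≤ 0 := by
    have h₀ : Matrix.toEuclideanCLM (𝕜 := ℂ) (phi1Proj N) (WithLp.toLp 2 (phi2 N)) = 0 := by
      rw [phi1Proj_eq, Matrix.toEuclideanCLM_toLp, Matrix.vecMulVec_mulVec, star_phi1,
        phi1_dotProduct_phi2]
      simp
    rw [map_sub, sub_apply, h₀, sub_zero]
    exact inner_phi2_diagonal_phaseCorr_re_nonpos hN
  have key := norm_rankOne_perturbation_le hε0 hε1 (norm_phi2 hN) _ _ hTPE hEv hvE hB hvB x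
  rw [← toEuclideanCLM_vecMulVec_star, ← phi2Proj_eq hN] at key
  rw [map_smul, smul_apply, norm_smul, Complex.norm_real, Real.norm_eq_abs,
    abs_of_pos (by positivity), map_add, map_add, map_smul, add_apply, add_apply, smul_apply,
    inv_mul_le_iff₀ (by positivity)]
  exact key.trans_eq (by ring)

end
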